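/- Let n ≥ 4 be even. For every n²×n² complex matrix X indexed by Fin n × Fin n with ‖X‖_tr ≤ 1, one has ‖(id_n ⊗ Φ_BH)(X)‖_tr ≤ (n+2)/n, where Φ_BH is the Breuer–Hall map. (Consequently the diamond norm of Φ_BH is at most (n+2)/n.) -/

import Mathlib

open Matrix BigOperators
open scoped ComplexOrder

noncomputable section

/-- The antisymmetric unitary `V` used in the Breuer–Hall map: in 0-indexed form,
`V i j = 1` if `j = n - 1 - i` and `i < n/2`, `V i j = -1` if `j = n - 1 - i` and
`i ≥ n/2`, and `V i j = 0` otherwise. -/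
def BHV (n : ℕ) : Matrix (Fin n) (Fin n) ℂ :=
  Matrix.of fun i j =>
    if (j : ℕ) = n - 1 - (i : ℕ) then (if (i : ℕ) < n / 2 then 1 else -1) else 0

/-- The Breuer–Hall map `Φ_BH : M_n(ℂ) → M_n(ℂ)`. -/
def PhiBH (n : ℕ) (X : Matrix (Fin n) (Fin n) ℂ) : Matrix (Fin n) (Fin n) ℂ :=
  ((1 : ℂ) / ((n : ℂ) - 2)) •
    (Matrix.trace X • (1 : Matrix (Fin n) (Fin n) ℂ) - X - BHV n * Xᵀ * (BHV n)ᴴ)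

/-- The map `id_n ⊗ Φ`, acting blockwise on an `n² × n²` matrix indexed by
`Fin n × Fin n`. -/
def idTensor {n : ℕ} (Φ : Matrix (Fin n) (Fin n) ℂ → Matrix (Fin n) (Fin n) ℂ)
    (X : Matrix (Fin n × Fin n) (Fin n × Fin n) ℂ) :
    Matrix (Fin n × Fin n) (Fin n × Fin n) ℂ :=
  Matrix.of fun p q => Φ (Matrix.of fun k l => X (p.1, k) (q.1, l)) p.2 q.2

/-- The trace norm of a square complex matrix: the sum of its singular values. -/
def traceNorm {d : Type*} [Fintype d] [DecidableEq d] (X : Matrix d d ℂ) : ℝ :=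
  ∑ i, Real.sqrt ((Matrix.posSemidef_conjTranspose_mul_self X).1.eigenvalues i)

section TraceNorm

open scoped InnerProductSpace

variable {d : Type*} [Fintype d] [DecidableEq d]

theorem toEuclideanLin_mul_apply (A B : Matrix d d ℂ) (x : EuclideanSpace ℂ d) :
    toEuclideanLin (A * B) x = toEuclideanLin A (toEuclideanLin B x) := by
  simp [toLpLin_apply]

theorem inner_toEuclideanLin_right (A : Matrix d d ℂ) (x y : EuclideanSpace ℂ d) :
    ⟪x, toEuclideanLin A y⟫_ℂ = ⟪toEuclideanLin Aᴴ x, y⟫_ℂ := by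
  rw [toEuclideanLin_conjTranspose_eq_adjoint, LinearMap.adjoint_inner_left]

/-- The right singular vectors of a matrix. -/
def rightSingularBasis (X : Matrix d d ℂ) : OrthonormalBasis d ℂ (EuclideanSpace ℂ d) :=
  (posSemidef_conjTranspose_mul_self X).1.eigenvectorBasis

/-- The singular values of a matrix, in the order of `rightSingularBasis`. -/
def singularValue (X : Matrix d d ℂ) (i : d) : ℝ :=
  √((posSemidef_conjTranspose_mul_self X).1.eigenvalues i)

theorem traceNorm_eq_sum_singularValue (X : Matrix d d ℂ) :
    traceNorm X = ∑ i, singularValue X i :=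
  rfl

theorem inner_toEuclideanLin_rightSingularBasis (X : Matrix d d ℂ) (i j : d) :
    ⟪toEuclideanLin X (rightSingularBasis X i), toEuclideanLin X (rightSingularBasis X j)⟫_ℂ =
      if i = j then (singularValue X j : ℂ) ^ 2 else 0 := by
  have h : toEuclideanLin (Xᴴ * X) (rightSingularBasis X j) =
      ((singularValue X j ^ 2 : ℝ) : ℂ) • rightSingularBasis X j := by
    rw [singularValue, Real.sq_sqrt ((posSemidef_conjTranspose_mul_self X).eigenvalues_nonneg j)]
    ext k
    have := congrFun ((posSemidef_conjTranspose_mul_self X).1.mulVec_eigenvectorBasis j) k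
    simpa [toLpLin_apply, rightSingularBasis] using this
  rw [← conjTranspose_conjTranspose X, ← inner_toEuclideanLin_right, conjTranspose_conjTranspose,
    ← toEuclideanLin_mul_apply, h, inner_smul_right,
    orthonormal_iff_ite.mp (rightSingularBasis X).orthonormal]
  simp

theorem norm_toEuclideanLin_rightSingularBasis (X : Matrix d d ℂ) (i : d) :
    ‖toEuclideanLin X (rightSingularBasis X i)‖ = singularValue X i := by
  have h := inner_toEuclideanLin_rightSingularBasis X i i
  rw [inner_self_eq_norm_sq_to_K, if_pos rfl] at h
  exact (sq_eq_sq₀ (norm_nonneg _) (Real.sqrt_nonneg _)).mp 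
    (Complex.ofReal_injective (by push_cast; exact h))

/-- `X = ∑ j, |a j⟩⟨b j|`. -/
def IsRankOneSum {ι : Type*} [Fintype ι] (X : Matrix d d ℂ) (a b : ι → EuclideanSpace ℂ d) :
    Prop :=
  ∀ z, toEuclideanLin X z = ∑ j, ⟪b j, z⟫_ℂ • a j

theorem isRankOneSum_rightSingularBasis (X : Matrix d d ℂ) :
    IsRankOneSum X (fun i => toEuclideanLin X (rightSingularBasis X i)) (rightSingularBasis X) := by
  intro z
  conv_lhs => rw [← (rightSingularBasis X).sum_repr' z]
  simp only [map_sum, map_smul]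

theorem exists_isRankOneSum_traceNorm (X : Matrix d d ℂ) :
    ∃ a b : d → EuclideanSpace ℂ d, IsRankOneSum X a b ∧ ∑ i, ‖a i‖ * ‖b i‖ = traceNorm X :=
  ⟨_, _, isRankOneSum_rightSingularBasis X, by
    simp [norm_toEuclideanLin_rightSingularBasis, traceNorm_eq_sum_singularValue]⟩

theorem IsRankOneSum.traceNorm_le {ι : Type*} [Fintype ι] {X : Matrix d d ℂ}
    {a b : ι → EuclideanSpace ℂ d} (h : IsRankOneSum X a b) :
    traceNorm X ≤ ∑ j, ‖a j‖ * ‖b j‖ := by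
  set u := rightSingularBasis X with hu
  set s := singularValue X with hs
  let w : d → EuclideanSpace ℂ d := fun i => ((s i)⁻¹ : ℂ) • toEuclideanLin X (u i)
  have hw : Orthonormal ℂ (fun i : {i // s i ≠ 0} => w i) := by
    rw [orthonormal_iff_ite]
    rintro ⟨i, hi⟩ ⟨j, hj⟩
    have hj' : (s j : ℂ) ≠ 0 := by exact_mod_cast hj
    simp only [w, inner_smul_left, inner_smul_right, hu, inner_toEuclideanLin_rightSingularBasis,
      Subtype.mk.injEq]
    split_ifs with hij
    · subst hij
      simp only [← hs, map_inv₀, Complex.conj_ofReal]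
      field_simp
    · simp
  have bessel : ∀ x, ∑ i, ‖⟪w i, x⟫_ℂ‖ ^ 2 ≤ ‖x‖ ^ 2 := by
    intro x
    refine le_trans (le_of_eq ?_) (hw.sum_inner_products_le x (s := Finset.univ))
    rw [← Finset.sum_subset (Finset.subset_univ ({i | s i ≠ 0} : Finset d))]
    · exact Finset.sum_subtype _ (by simp) fun i => ‖⟪w i, x⟫_ℂ‖ ^ 2
    · intro i _ hi
      have h0 : s i = 0 := by simpa using hi
      simp [w, h0]
  have hsum : ∀ i, (s i : ℂ) = ∑ j, ⟪b j, u i⟫_ℂ * ⟪w i, a j⟫_ℂ := by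
    intro i
    have h1 : ∑ j, ⟪b j, u i⟫_ℂ * ⟪w i, a j⟫_ℂ = ⟪w i, toEuclideanLin X (u i)⟫_ℂ := by
      rw [h, inner_sum]
      simp only [inner_smul_right]
    rw [h1]
    simp only [w, inner_smul_left, hu, inner_toEuclideanLin_rightSingularBasis, if_true, ← hs,
      map_inv₀, Complex.conj_ofReal]
    by_cases h0 : (s i : ℂ) = 0
    · simp [h0]
    · field_simp
  have hterm : ∀ j, ∑ i, ‖⟪b j, u i⟫_ℂ‖ * ‖⟪w i, a j⟫_ℂ‖ ≤ ‖a j‖ * ‖b j‖ := by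
    intro j
    refine (Real.sum_mul_le_sqrt_mul_sqrt _ _ _).trans ?_
    rw [u.sum_sq_norm_inner_left, Real.sqrt_sq (norm_nonneg _), mul_comm]
    gcongr
    exact Real.sqrt_le_iff.mpr ⟨norm_nonneg _, bessel _⟩
  calc traceNorm X = ∑ i, s i := rfl
    _ ≤ ∑ i, ∑ j, ‖⟪b j, u i⟫_ℂ‖ * ‖⟪w i, a j⟫_ℂ‖ := by
      refine Finset.sum_le_sum fun i _ => ?_
      have h2 : s i = ‖(s i : ℂ)‖ := by
        rw [Complex.norm_real]; exact (Real.norm_of_nonneg (Real.sqrt_nonneg _)).symm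
      rw [h2, hsum]
      refine (norm_sum_le _ _).trans (le_of_eq ?_)
      simp only [norm_mul]
    _ = ∑ j, ∑ i, ‖⟪b j, u i⟫_ℂ‖ * ‖⟪w i, a j⟫_ℂ‖ := Finset.sum_comm
    _ ≤ _ := Finset.sum_le_sum fun j _ => hterm j

theorem traceNorm_add_le (X Y : Matrix d d ℂ) :
    traceNorm (X + Y) ≤ traceNorm X + traceNorm Y := by
  obtain ⟨a, b, hX, hXs⟩ := exists_isRankOneSum_traceNorm X
  obtain ⟨a', b', hY, hYs⟩ := exists_isRankOneSum_traceNorm Y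
  have h : IsRankOneSum (X + Y) (Sum.elim a a') (Sum.elim b b') := fun z => by
    simp [hX z, hY z]
  simpa [hXs, hYs] using h.traceNorm_le

theorem traceNorm_smul_le (c : ℂ) (X : Matrix d d ℂ) :
    traceNorm (c • X) ≤ ‖c‖ * traceNorm X := by
  obtain ⟨a, b, hX, hXs⟩ := exists_isRankOneSum_traceNorm X
  have h : IsRankOneSum (c • X) (fun i => c • a i) b := fun z => by
    simp [hX z, Finset.smul_sum, smul_comm c]
  simpa [← hXs, Finset.mul_sum, norm_smul, mul_assoc] using h.traceNorm_le

theorem sum_norm_sq_toEuclideanLin {κ : Type*} [Fintype κ] {L : κ → Matrix d d ℂ} {c : ℝ}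
    (hL : ∑ k, (L k)ᴴ * L k = (c : ℂ) • 1) (x : EuclideanSpace ℂ d) :
    ∑ k, ‖toEuclideanLin (L k) x‖ ^ 2 = c * ‖x‖ ^ 2 := by
  have h : ∑ k, ⟪toEuclideanLin (L k) x, toEuclideanLin (L k) x⟫_ℂ = (c : ℂ) * ⟪x, x⟫_ℂ := by
    have h1 : toEuclideanLin (∑ k, (L k)ᴴ * L k) x = (c : ℂ) • x := by
      rw [hL, map_smul, LinearMap.smul_apply]; simp
    rw [← inner_smul_right, ← h1, map_sum, LinearMap.sum_apply, inner_sum]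
    refine Finset.sum_congr rfl fun k _ => ?_
    rw [toEuclideanLin_mul_apply, inner_toEuclideanLin_right _ x, conjTranspose_conjTranspose]
  simp only [inner_self_eq_norm_sq_to_K] at h
  exact Complex.ofReal_injective (by push_cast; exact h)

theorem traceNorm_sum_mul_mul_conjTranspose_le {κ : Type*} [Fintype κ] {L : κ → Matrix d d ℂ}
    {c : ℝ} (hc : 0 ≤ c) (hL : ∑ k, (L k)ᴴ * L k = (c : ℂ) • 1) (X : Matrix d d ℂ) :
    traceNorm (∑ k, L k * X * (L k)ᴴ) ≤ c * traceNorm X := by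
  obtain ⟨a, b, hX, hXs⟩ := exists_isRankOneSum_traceNorm X
  have h : IsRankOneSum (∑ k, L k * X * (L k)ᴴ)
      (fun p : d × κ => toEuclideanLin (L p.2) (a p.1))
      (fun p => toEuclideanLin (L p.2) (b p.1)) := fun z => by
    rw [map_sum, LinearMap.sum_apply, Fintype.sum_prod_type_right]
    refine Finset.sum_congr rfl fun k _ => ?_
    rw [toEuclideanLin_mul_apply, toEuclideanLin_mul_apply, hX, map_sum]
    simp only [map_smul, inner_toEuclideanLin_right, conjTranspose_conjTranspose]
  refine h.traceNorm_le.trans ?_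
  rw [Fintype.sum_prod_type, ← hXs, Finset.mul_sum]
  refine Finset.sum_le_sum fun i _ => ?_
  refine (Real.sum_mul_le_sqrt_mul_sqrt _ _ _).trans (le_of_eq ?_)
  dsimp only
  rw [sum_norm_sq_toEuclideanLin hL, sum_norm_sq_toEuclideanLin hL, Real.sqrt_mul hc,
    Real.sqrt_mul hc, Real.sqrt_sq (norm_nonneg _), Real.sqrt_sq (norm_nonneg _)]
  rw [mul_mul_mul_comm, Real.mul_self_sqrt hc]

end TraceNorm

section Kraus

variable {n : ℕ}

theorem sum_single_mul_mul_single (Y : Matrix (Fin n) (Fin n) ℂ) :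
    ∑ p : Fin n × Fin n, single p.1 p.2 1 * Y * single p.1 p.2 1 = Yᵀ := by
  simp only [single_mul_mul_single, one_mul, mul_one]
  rw [Fintype.sum_prod_type]
  exact (matrix_eq_sum_single Yᵀ).symm

theorem sum_single_mul_mul_single_swap (Y : Matrix (Fin n) (Fin n) ℂ) :
    ∑ p : Fin n × Fin n, single p.1 p.2 1 * Y * single p.2 p.1 1 = Y.trace • 1 := by
  simp only [single_mul_mul_single, one_mul, mul_one]
  ext i j
  simp [Fintype.sum_prod_type, Matrix.sum_apply, single_apply, one_apply, trace, ite_and]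

/-- The symplectic-type involution `M ↦ V Mᵀ Vᴴ`. -/
def twist (V M : Matrix (Fin n) (Fin n) ℂ) : Matrix (Fin n) (Fin n) ℂ :=
  V * Mᵀ * Vᴴ

/-- Up to scaling, the Kraus operators of `Φ_BH + (1/n) id`: the projections of the matrix units
onto the trace-zero matrices fixed by `twist V`. -/
def krausBH (V : Matrix (Fin n) (Fin n) ℂ) (p : Fin n × Fin n) : Matrix (Fin n) (Fin n) ℂ :=
  (1 / 2 : ℂ) • (single p.1 p.2 1 + twist V (single p.1 p.2 1)) -
    (if p.1 = p.2 then (1 / n : ℂ) else 0) • 1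

theorem conjTranspose_krausBH (V : Matrix (Fin n) (Fin n) ℂ) (p : Fin n × Fin n) :
    (krausBH V p)ᴴ = krausBH V p.swap := by
  simp only [krausBH, twist, Prod.fst_swap, Prod.snd_swap, eq_comm (a := p.2)]
  split_ifs <;> simp [mul_assoc]

theorem krausBH_mul_mul_krausBH_swap (V X : Matrix (Fin n) (Fin n) ℂ) (p : Fin n × Fin n) :
    krausBH V p * X * krausBH V p.swap =
      (1 / 4 : ℂ) • (single p.1 p.2 1 * X * single p.2 p.1 1) +
      (1 / 4 : ℂ) • (single p.1 p.2 1 * (X * V) * single p.1 p.2 1 * Vᴴ) +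
      (1 / 4 : ℂ) • (V * (single p.2 p.1 1 * (Vᴴ * X) * single p.2 p.1 1)) +
      (1 / 4 : ℂ) • (V * (single p.2 p.1 1 * (Vᴴ * X * V) * single p.1 p.2 1) * Vᴴ) -
      (1 / 2 : ℂ) • ((if p.1 = p.2 then (1 / n : ℂ) else 0) •
        (single p.1 p.2 1 + V * single p.2 p.1 1 * Vᴴ) * X) -
      (1 / 2 : ℂ) • (X * (if p.1 = p.2 then (1 / n : ℂ) else 0) •
        (single p.2 p.1 1 + V * single p.1 p.2 1 * Vᴴ)) +
      (if p.1 = p.2 then (1 / n : ℂ) ^ 2 else 0) • X := by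
  have h : (if p.1 = p.2 then (1 / n : ℂ) ^ 2 else 0) =
      (if p.1 = p.2 then (1 / n : ℂ) else 0) ^ 2 := by split_ifs <;> simp
  rw [h]
  simp only [krausBH, twist, Prod.fst_swap, Prod.snd_swap, eq_comm (a := p.2), transpose_single]
  generalize (if p.1 = p.2 then (1 / n : ℂ) else 0) = c
  simp only [sub_mul, mul_sub, add_mul, mul_add, smul_mul_assoc, mul_smul_comm, mul_assoc,
    one_mul, mul_one]
  module

theorem sum_ite_smul_single (c : ℂ) :
    ∑ p : Fin n × Fin n, (if p.1 = p.2 then c else 0) • single p.1 p.2 (1 : ℂ) = c • 1 := by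
  rw [Fintype.sum_prod_type]
  simp only [ite_smul, zero_smul, Finset.sum_ite_eq, Finset.mem_univ, if_true]
  rw [← Finset.smul_sum, sum_single_one]

theorem sum_ite_smul_single_swap (c : ℂ) :
    ∑ p : Fin n × Fin n, (if p.1 = p.2 then c else 0) • single p.2 p.1 (1 : ℂ) = c • 1 := by
  rw [Fintype.sum_prod_type]
  simp only [ite_smul, zero_smul, Finset.sum_ite_eq, Finset.mem_univ, if_true]
  rw [← Finset.smul_sum, sum_single_one]

theorem sum_krausBH (hn : n ≠ 0) {V : Matrix (Fin n) (Fin n) ℂ} (hVT : Vᵀ = -V)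
    (hV : V * Vᴴ = 1) (X : Matrix (Fin n) (Fin n) ℂ) :
    ∑ p, krausBH V p * X * krausBH V p.swap =
      (1 / 2 : ℂ) • (X.trace • 1 - V * Xᵀ * Vᴴ) - (1 / n : ℂ) • X := by
  have hn' : (n : ℂ) ≠ 0 := by exact_mod_cast hn
  have hVHT : (Vᴴ)ᵀ = -Vᴴ := by
    rw [← conjTranspose_neg, ← hVT]; rfl
  have swap_sum (f : Fin n × Fin n → Matrix (Fin n) (Fin n) ℂ) :
      ∑ p : Fin n × Fin n, f p.swap = ∑ p, f p :=
    (Equiv.prodComm _ _).sum_comp f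
  have h2 : ∑ p : Fin n × Fin n, single p.1 p.2 1 * (X * V) * single p.1 p.2 1 * Vᴴ =
      -(V * Xᵀ * Vᴴ) := by
    rw [← Finset.sum_mul, sum_single_mul_mul_single, transpose_mul, hVT]
    simp
  have h3 : ∑ p : Fin n × Fin n, V * (single p.2 p.1 1 * (Vᴴ * X) * single p.2 p.1 1) =
      -(V * Xᵀ * Vᴴ) := by
    rw [← Finset.mul_sum, ← swap_sum]
    simp only [Prod.fst_swap, Prod.snd_swap]
    rw [sum_single_mul_mul_single, transpose_mul, hVHT]
    simp [mul_assoc]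
  have h4 : ∑ p : Fin n × Fin n,
      V * (single p.2 p.1 1 * (Vᴴ * X * V) * single p.1 p.2 1) * Vᴴ = X.trace • 1 := by
    rw [← Finset.sum_mul, ← Finset.mul_sum, ← swap_sum]
    simp only [Prod.fst_swap, Prod.snd_swap]
    rw [sum_single_mul_mul_single_swap, trace_mul_comm, ← mul_assoc, hV, one_mul]
    simp [hV]
  have h5 : ∑ p : Fin n × Fin n, (if p.1 = p.2 then (1 / n : ℂ) else 0) •
      (single p.1 p.2 1 + V * single p.2 p.1 1 * Vᴴ) = (2 / n : ℂ) • 1 := by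
    simp only [smul_add, Finset.sum_add_distrib, ← smul_mul_assoc _ (V * _), ← mul_smul_comm _ V]
    rw [← Finset.sum_mul, ← Finset.mul_sum, sum_ite_smul_single, sum_ite_smul_single_swap,
      mul_smul_comm, smul_mul_assoc, mul_one, hV]
    module
  have h6 : ∑ p : Fin n × Fin n, (if p.1 = p.2 then (1 / n : ℂ) else 0) •
      (single p.2 p.1 1 + V * single p.1 p.2 1 * Vᴴ) = (2 / n : ℂ) • 1 := by
    rw [← h5, ← swap_sum]
    simp only [Prod.fst_swap, Prod.snd_swap, eq_comm]
  have h7 : ∑ p : Fin n × Fin n, (if p.1 = p.2 then (1 / n : ℂ) ^ 2 else 0) = 1 / n := by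
    rw [Fintype.sum_prod_type]
    simp
    field_simp
  simp only [krausBH_mul_mul_krausBH_swap, Finset.sum_add_distrib, Finset.sum_sub_distrib]
  simp only [← Finset.smul_sum, ← Finset.sum_mul (a := X), ← Finset.mul_sum (a := X),
    ← Finset.sum_smul]
  rw [sum_single_mul_mul_single_swap, h2, h3, h4, h5, h6, h7]
  simp only [smul_mul_assoc, mul_smul_comm, one_mul, mul_one]
  module

theorem sum_conjTranspose_krausBH_mul (hn : n ≠ 0) {V : Matrix (Fin n) (Fin n) ℂ}
    (hVT : Vᵀ = -V) (hV : V * Vᴴ = 1) :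
    ∑ p, (krausBH V p)ᴴ * krausBH V p = (((n - 1) / 2 - 1 / n : ℝ) : ℂ) • 1 := by
  have h := sum_krausBH hn hVT hV 1
  rw [← (Equiv.prodComm _ _).sum_comp] at h
  simp only [Equiv.prodComm_apply, Prod.swap_swap, mul_one, transpose_one, hV, trace_one,
    Fintype.card_fin, ← conjTranspose_krausBH] at h
  rw [h]
  push_cast
  module

end Kraus

section BreuerHall

variable {n : ℕ}

theorem BHV_apply (i j : Fin n) :
    BHV n i j = if j = i.rev then (if (i : ℕ) < n / 2 then 1 else -1) else 0 := by
  have h : (j : ℕ) = n - 1 - i ↔ j = i.rev := by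
    rw [Fin.ext_iff, Fin.val_rev]; omega
  simp [BHV, h]

theorem BHV_transpose (hne : Even n) : (BHV n)ᵀ = -BHV n := by
  obtain ⟨m, rfl⟩ := hne
  ext i j
  change BHV _ j i = -BHV _ i j
  simp only [BHV_apply]
  by_cases h : j = i.rev
  · subst h
    simp only [Fin.rev_rev, if_true, Fin.val_rev]
    split_ifs <;> first | omega | simp
  · rw [if_neg h, if_neg fun h' => h (by rw [h', Fin.rev_rev]), neg_zero]

theorem BHV_mul_conjTranspose : BHV n * (BHV n)ᴴ = 1 := by
  ext i j
  simp only [mul_apply, conjTranspose_apply, BHV_apply, one_apply, ite_mul, zero_mul,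
    Finset.sum_ite_eq', Finset.mem_univ, if_true, Fin.rev_inj]
  split_ifs <;> simp_all

theorem PhiBH_eq (hn : 4 ≤ n) (hne : Even n) (X : Matrix (Fin n) (Fin n) ℂ) :
    PhiBH n X = (2 / (n - 2) : ℂ) • ∑ p, krausBH (BHV n) p * X * (krausBH (BHV n) p)ᴴ +
      (-(1 / n) : ℂ) • X := by
  have h0 : (n : ℂ) ≠ 0 := by exact_mod_cast (by omega : n ≠ 0)
  have h2 : (n : ℂ) - 2 ≠ 0 := sub_ne_zero.mpr (by exact_mod_cast (by omega : n ≠ 2))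
  simp only [conjTranspose_krausBH]
  rw [sum_krausBH (by omega) (BHV_transpose hne) BHV_mul_conjTranspose, PhiBH]
  match_scalars <;> field_simp
  ring

open scoped Kronecker

theorem idTensor_mul_mul_conjTranspose (K : Matrix (Fin n) (Fin n) ℂ)
    (X : Matrix (Fin n × Fin n) (Fin n × Fin n) ℂ) :
    idTensor (fun M => K * M * Kᴴ) X = ((1 : Matrix (Fin n) (Fin n) ℂ) ⊗ₖ K) * X * (1 ⊗ₖ K)ᴴ := by
  ext ⟨a, k⟩ ⟨b, l⟩
  simp [idTensor, mul_apply, Fintype.sum_prod_type, one_apply, Finset.sum_mul, apply_ite star,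
    Finset.sum_ite_irrel]

theorem idTensor_PhiBH (hn : 4 ≤ n) (hne : Even n)
    (X : Matrix (Fin n × Fin n) (Fin n × Fin n) ℂ) :
    idTensor (PhiBH n) X =
      (2 / (n - 2) : ℂ) • ∑ p, ((1 : Matrix (Fin n) (Fin n) ℂ) ⊗ₖ krausBH (BHV n) p) * X *
        (1 ⊗ₖ krausBH (BHV n) p)ᴴ + (-(1 / n) : ℂ) • X := by
  simp only [← idTensor_mul_mul_conjTranspose]
  ext a b
  simp [idTensor, PhiBH_eq hn hne, Matrix.sum_apply]

theorem sum_conjTranspose_kronecker_krausBH_mul (hn : n ≠ 0) (hne : Even n) :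
    ∑ p, ((1 : Matrix (Fin n) (Fin n) ℂ) ⊗ₖ krausBH (BHV n) p)ᴴ * (1 ⊗ₖ krausBH (BHV n) p) =
      (((n - 1) / 2 - 1 / n : ℝ) : ℂ) • 1 := by
  simp only [conjTranspose_kronecker, conjTranspose_one, ← mul_kronecker_mul, one_mul]
  have h (f : Fin n × Fin n → Matrix (Fin n) (Fin n) ℂ) :
      ∑ p, (1 : Matrix (Fin n) (Fin n) ℂ) ⊗ₖ f p = 1 ⊗ₖ ∑ p, f p := by
    ext a b
    simp [Matrix.sum_apply, Finset.mul_sum]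
  rw [h, sum_conjTranspose_krausBH_mul hn (BHV_transpose hne) BHV_mul_conjTranspose,
    kronecker_smul, one_kronecker_one]

end BreuerHall

/-- The diamond norm of the Breuer–Hall map is at most `(n+2)/n` for even `n ≥ 4`. -/
theorem diamond_norm_PhiBH_le {n : ℕ} (hn : 4 ≤ n) (hne : Even n)
    (X : Matrix (Fin n × Fin n) (Fin n × Fin n) ℂ) (hX : traceNorm X ≤ 1) :
    traceNorm (idTensor (PhiBH n) X) ≤ ((n : ℝ) + 2) / n := by
  have hn4 : (4 : ℝ) ≤ n := by exact_mod_cast hn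
  have hc : (0 : ℝ) ≤ (n - 1) / 2 - 1 / n := by
    have : (1 : ℝ) / n ≤ 1 := by rw [div_le_one (by linarith)]; linarith
    linarith
  have hX0 : 0 ≤ traceNorm X := Finset.sum_nonneg fun i _ => Real.sqrt_nonneg _
  have h1 : ‖(2 / (n - 2) : ℂ)‖ = 2 / ((n : ℝ) - 2) := by
    rw [show (2 / (n - 2) : ℂ) = ((2 / ((n : ℝ) - 2) : ℝ) : ℂ) by push_cast; rfl,
      Complex.norm_real, Real.norm_of_nonneg (div_nonneg (by norm_num) (by linarith))]
  have h2 : ‖(-(1 / n) : ℂ)‖ = 1 / (n : ℝ) := by simp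
  rw [idTensor_PhiBH hn hne]
  refine (traceNorm_add_le _ _).trans ((add_le_add (traceNorm_smul_le _ _)
    (traceNorm_smul_le _ _)).trans ?_)
  rw [h1, h2]
  have h3 := traceNorm_sum_mul_mul_conjTranspose_le hc
    (sum_conjTranspose_kronecker_krausBH_mul (by omega) hne) X
  have h4 : (0 : ℝ) < n - 2 := by linarith
  calc _ ≤ 2 / ((n : ℝ) - 2) * (((n - 1) / 2 - 1 / n) * traceNorm X) + 1 / n * traceNorm X := by
        gcongr
    _ = (n + 2) / n * traceNorm X := by field_simp; ring
    _ ≤ (n + 2) / n * 1 := by gcongr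
    _ = _ := mul_one _

end
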